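/- arXiv:2504.13485 — 3 statements merged into one kernel-verified Lean document; each statement's English description precedes it below -/
import Mathlib

section
/- For every ξ ∈ ℝ^d with ‖ξ‖ < 1, the linear map M(ξ) (the mixed Hessian of the phase, equal to the derivative of g at ξ) fails to be invertible if and only if ⟨σ(ξ), a⟩ = 0, i.e. if and only if σ(ξ) lies in the hyperplane G·{0}×ℝ^d with normal vector a = (Gᵀ)⁻¹ e₀. -/
open Matrix

noncomputable section

/-- `f ξ = √(1 - ‖ξ‖²)` (Euclidean norm, written via the dot product). -/
def fH {d : ℕ} (ξ : Fin d → ℝ) : ℝ := Real.sqrt (1 - ξ ⬝ᵥ ξ)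

/-- `σ ξ = (f ξ, ξ) ∈ ℝ^{1+d}`. -/
def sigmaH {d : ℕ} (ξ : Fin d → ℝ) : Fin (d + 1) → ℝ := Fin.cons (fH ξ) ξ

/-- `π (x₀, x) = x`. -/
def piH {d : ℕ} (z : Fin (d + 1) → ℝ) : Fin d → ℝ := fun i => z i.succ

/-- `e₀ = (1, 0, …, 0)`. -/
def e0H {d : ℕ} : Fin (d + 1) → ℝ := fun i => if i = 0 then 1 else 0

/-- the lower-right `d × d` block of `G`. -/
def G0H {d : ℕ} (G : Matrix (Fin (d + 1)) (Fin (d + 1)) ℝ) : Matrix (Fin d) (Fin d) ℝ :=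
  fun i j => G i.succ j.succ

/-- `b = π (Gᵀ e₀)`. -/
def bH {d : ℕ} (G : Matrix (Fin (d + 1)) (Fin (d + 1)) ℝ) : Fin d → ℝ :=
  piH (Gᵀ.mulVec e0H)

/-- `g ξ = π (Gᵀ σ(ξ))`. -/
def gH {d : ℕ} (G : Matrix (Fin (d + 1)) (Fin (d + 1)) ℝ) (ξ : Fin d → ℝ) : Fin d → ℝ :=
  piH (Gᵀ.mulVec (sigmaH ξ))

/-- `a = (Gᵀ)⁻¹ e₀`. -/
def aH {d : ℕ} (G : Matrix (Fin (d + 1)) (Fin (d + 1)) ℝ) : Fin (d + 1) → ℝ :=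
  (Gᵀ)⁻¹.mulVec e0H

/-- The matrix of the linear map `M(ξ) : v ↦ G₀ᵀ v - (⟨ξ, v⟩ / f ξ) • b`. -/
def MH {d : ℕ} (G : Matrix (Fin (d + 1)) (Fin (d + 1)) ℝ) (ξ : Fin d → ℝ) :
    Matrix (Fin d) (Fin d) ℝ :=
  (G0H G)ᵀ - (fH ξ)⁻¹ • vecMulVec (bH G) ξ

/-- The tangent vector `(-⟨ξ, v⟩ / f ξ, v)` to the sphere at `σ ξ` that projects to `v`. -/
def tangentLift {d : ℕ} (ξ v : Fin d → ℝ) : Fin (d + 1) → ℝ :=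
  Fin.cons (-((fH ξ)⁻¹ * (ξ ⬝ᵥ v))) v

theorem fH_pos {d : ℕ} {ξ : Fin d → ℝ} (hξ : ξ ⬝ᵥ ξ < 1) : 0 < fH ξ :=
  Real.sqrt_pos.2 (by linarith)

theorem sigmaH_dotProduct {d : ℕ} (ξ : Fin d → ℝ) (z : Fin (d + 1) → ℝ) :
    sigmaH ξ ⬝ᵥ z = fH ξ * z 0 + ξ ⬝ᵥ piH z := by
  simp [dotProduct, Fin.sum_univ_succ, sigmaH, piH]

theorem sigmaH_dotProduct_tangentLift {d : ℕ} {ξ : Fin d → ℝ} (hf : fH ξ ≠ 0)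
    (v : Fin d → ℝ) : sigmaH ξ ⬝ᵥ tangentLift ξ v = 0 := by
  have hv : piH (tangentLift ξ v) = v := rfl
  rw [sigmaH_dotProduct, hv, tangentLift, Fin.cons_zero]
  field_simp
  ring

theorem tangentLift_piH {d : ℕ} {ξ : Fin d → ℝ} (hf : fH ξ ≠ 0) {z : Fin (d + 1) → ℝ}
    (hz : sigmaH ξ ⬝ᵥ z = 0) : tangentLift ξ (piH z) = z := by
  rw [sigmaH_dotProduct] at hz
  ext i
  refine Fin.cases ?_ (fun j => rfl) i
  rw [tangentLift, Fin.cons_zero]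
  field_simp
  linarith

theorem MH_mulVec {d : ℕ} (G : Matrix (Fin (d + 1)) (Fin (d + 1)) ℝ) (ξ v : Fin d → ℝ) :
    MH G ξ *ᵥ v = piH (Gᵀ *ᵥ tangentLift ξ v) := by
  ext i
  simp only [MH, sub_mulVec, smul_mulVec, vecMulVec_mulVec]
  simp [piH, mulVec, dotProduct, Fin.sum_univ_succ, tangentLift, bH, G0H, e0H]
  ring

theorem eq_smul_e0H_of_piH_eq_zero {d : ℕ} {z : Fin (d + 1) → ℝ} (hz : piH z = 0) :
    z = z 0 • e0H := by
  ext i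
  refine Fin.cases (by simp [e0H]) (fun j => ?_) i
  simpa [e0H, piH] using congrFun hz j

theorem mulVec_aH {d : ℕ} {G : Matrix (Fin (d + 1)) (Fin (d + 1)) ℝ} (hG : IsUnit G.det) :
    Gᵀ *ᵥ aH G = e0H := by
  rw [aH, mulVec_mulVec, mul_nonsing_inv _ (by rwa [det_transpose]), one_mulVec]

/-- `M(ξ)` fails to be invertible iff `⟨σ(ξ), a⟩ = 0`, where `a = (Gᵀ)⁻¹ e₀`. -/
theorem stmt_3 (d : ℕ) (hd : 1 ≤ d) (G : Matrix (Fin (d + 1)) (Fin (d + 1)) ℝ)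
    (hG : IsUnit G.det) (ξ : Fin d → ℝ) (hξ : ξ ⬝ᵥ ξ < 1) :
    ¬ IsUnit (MH G ξ) ↔ sigmaH ξ ⬝ᵥ aH G = 0 := by
  have hf : fH ξ ≠ 0 := (fH_pos hξ).ne'
  rw [isUnit_iff_isUnit_det, isUnit_iff_ne_zero, not_not, ← exists_mulVec_eq_zero_iff]
  constructor
  · rintro ⟨v, hv, hM⟩
    rw [MH_mulVec] at hM
    obtain ⟨c, hc⟩ : ∃ c : ℝ, Gᵀ *ᵥ tangentLift ξ v = c • e0H :=
      ⟨_, eq_smul_e0H_of_piH_eq_zero hM⟩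
    have hw : tangentLift ξ v = c • aH G := by
      rw [aH, ← mulVec_smul, ← hc, mulVec_mulVec,
        nonsing_inv_mul _ (by rwa [det_transpose]), one_mulVec]
    have h := sigmaH_dotProduct_tangentLift hf v
    rw [hw, dotProduct_smul, smul_eq_mul] at h
    refine (mul_eq_zero.1 h).resolve_left fun hc0 => hv ?_
    rw [hc0, zero_smul] at hw
    exact congrArg piH hw
  · intro h
    have hlift := tangentLift_piH hf h
    refine ⟨piH (aH G), fun h0 => ?_, ?_⟩
    · have ha : aH G = 0 := by
        rw [← hlift, h0]
        ext i
        refine Fin.cases ?_ (fun j => rfl) i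
        simp [tangentLift]
      have he := congrFun (mulVec_aH hG) 0
      simp [ha, e0H] at he
    · rw [MH_mulVec, hlift, mulVec_aH hG]
      ext i
      simp [piH, e0H]

end
end

section
/- For every (x, ξ) ∈ ℝ^d × ℝ^d with ‖ξ‖ < 1, the map κ_{U_γ} is differentiable at (x, ξ) and its derivative L preserves the standard symplectic form: ω(L(u, v), L(u', v')) = ω((u, v), (u', v')) for all (u, v), (u', v') ∈ ℝ^d × ℝ^d. -/
open Matrix

noncomputable section

/-- `κ_{U_γ} (x, ξ) = (x + γ₀ ξ / f(ξ) − γ', ξ)`. -/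
def kappaT {d : ℕ} (γ₀ : ℝ) (γ' : Fin d → ℝ) (p : (Fin d → ℝ) × (Fin d → ℝ)) :
    (Fin d → ℝ) × (Fin d → ℝ) :=
  (p.1 + (γ₀ / fH p.2) • p.2 - γ', p.2)

theorem hasFDerivAt_dotProduct_self {ι : Type*} [Fintype ι] (ξ : ι → ℝ) :
    HasFDerivAt (fun η : ι → ℝ => η ⬝ᵥ η)
      (∑ i, (2 * ξ i) • (ContinuousLinearMap.proj i : (ι → ℝ) →L[ℝ] ℝ)) ξ := by
  simp only [dotProduct]
  refine HasFDerivAt.fun_sum fun i _ => ?_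
  refine ((hasFDerivAt_apply i ξ).mul (hasFDerivAt_apply i ξ)).congr_fderiv ?_
  ext v
  simp
  ring

theorem hasFDerivAt_const_div_fH {d : ℕ} (c : ℝ) {ξ : Fin d → ℝ} (hξ : ξ ⬝ᵥ ξ < 1) :
    ∃ k : ℝ, HasFDerivAt (fun η : Fin d → ℝ => c / fH η)
      (k • ∑ i, (2 * ξ i) • (ContinuousLinearMap.proj i : (Fin d → ℝ) →L[ℝ] ℝ)) ξ := by
  have hpos : 0 < 1 - ξ ⬝ᵥ ξ := sub_pos.2 hξ
  have hd : DifferentiableAt ℝ (fun t : ℝ => c / Real.sqrt (1 - t)) (ξ ⬝ᵥ ξ) :=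
    (differentiableAt_const c).div
      (((differentiableAt_const 1).sub differentiableAt_id).sqrt hpos.ne')
      (Real.sqrt_pos.2 hpos).ne'
  exact ⟨_, HasDerivAt.comp_hasFDerivAt (f := fun η : Fin d → ℝ => η ⬝ᵥ η) ξ hd.hasDerivAt
    (hasFDerivAt_dotProduct_self ξ)⟩

/-- `κ_{U_γ}` is differentiable at every point of `ℝ^d × {‖ξ‖ < 1}` and its derivative
preserves the standard symplectic form `ω((u,v),(u',v')) = ⟨v,u'⟩ − ⟨u,v'⟩`. -/
theorem stmt_11 (d : ℕ) (hd : 1 ≤ d) (γ₀ : ℝ) (γ' : Fin d → ℝ)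
    (x ξ : Fin d → ℝ) (hξ : ξ ⬝ᵥ ξ < 1) :
    ∃ L : ((Fin d → ℝ) × (Fin d → ℝ)) →L[ℝ] ((Fin d → ℝ) × (Fin d → ℝ)),
      HasFDerivAt (kappaT γ₀ γ') L (x, ξ) ∧
      ∀ p q : (Fin d → ℝ) × (Fin d → ℝ),
        (L p).2 ⬝ᵥ (L q).1 - (L p).1 ⬝ᵥ (L q).2 = p.2 ⬝ᵥ q.1 - p.1 ⬝ᵥ q.2 := by
  obtain ⟨k, hk⟩ := hasFDerivAt_const_div_fH γ₀ hξ
  have hsnd : HasFDerivAt (Prod.snd : (Fin d → ℝ) × (Fin d → ℝ) → Fin d → ℝ)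
      (ContinuousLinearMap.snd ℝ _ _) (x, ξ) := hasFDerivAt_snd
  refine ⟨_, ((hasFDerivAt_fst.add
    ((HasFDerivAt.comp (x, ξ) hk hsnd).smul hsnd)).sub_const γ').prodMk hsnd, fun p q => ?_⟩
  have hgrad (v : Fin d → ℝ) : ∑ i, 2 * ξ i * v i = 2 * (v ⬝ᵥ ξ) := by
    simp only [dotProduct, Finset.mul_sum]
    exact Finset.sum_congr rfl fun i _ => by ring
  simp [hgrad, dotProduct_comm ξ]
  ring

end
end

section
/- (Ray lemma, affine case.) Let 𝒢(X) := G X + γ with γ = (γ₀, γ') ∈ ℝ × ℝ^d. Let (x_A, ξ_A) ∈ ℝ^d × ℝ^d with ‖ξ_A‖ < 1 and ⟨σ(ξ_A), a⟩ ≠ 0 (so M(ξ_A) is invertible), and let (x_B, ξ_B) := κ_{U_G}(κ_{U_γ}(x_A, ξ_A)). Set A := (0, x_A) ∈ ℝ^{1+d} and B := 𝒢(0, x_B) = G·(0, x_B) + γ. Then B − A is collinear to σ(ξ_A), i.e. B − A = λ σ(ξ_A) for some λ ∈ ℝ. -/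
open Matrix

noncomputable section

/-- `κ_{U_G} (x, ξ) = ((M(ξ)ᵀ)⁻¹ x, g(ξ))`. -/
def kappaG {d : ℕ} (G : Matrix (Fin (d + 1)) (Fin (d + 1)) ℝ)
    (p : (Fin d → ℝ) × (Fin d → ℝ)) : (Fin d → ℝ) × (Fin d → ℝ) :=
  (((MH G p.2)ᵀ)⁻¹.mulVec p.1, gH G p.2)

theorem fH_ne_zero {d : ℕ} {ξ : Fin d → ℝ} (hξ : ξ ⬝ᵥ ξ < 1) : fH ξ ≠ 0 :=
  (Real.sqrt_pos.2 (sub_pos.2 hξ)).ne'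

theorem e0H_dotProduct {d : ℕ} (z : Fin (d + 1) → ℝ) : e0H ⬝ᵥ z = z 0 := by
  simp [e0H, dotProduct]

theorem bH_apply {d : ℕ} (G : Matrix (Fin (d + 1)) (Fin (d + 1)) ℝ) (j : Fin d) :
    bH G j = G 0 j.succ := by
  simp [bH, piH, mulVec, dotProduct, e0H]

theorem MH_transpose_mulVec {d : ℕ} (G : Matrix (Fin (d + 1)) (Fin (d + 1)) ℝ)
    (ξ y : Fin d → ℝ) :
    (MH G ξ)ᵀ *ᵥ y = G0H G *ᵥ y - (bH G ⬝ᵥ y / fH ξ) • ξ := by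
  ext i
  simp only [MH, transpose_sub, transpose_transpose, transpose_smul, transpose_vecMulVec,
    sub_mulVec, smul_mulVec, vecMulVec_mulVec, Pi.sub_apply, Pi.smul_apply, smul_eq_mul,
    MulOpposite.smul_eq_mul_unop, MulOpposite.unop_op]
  ring

/-- `G (0, y)` splits into a multiple of `σ ξ` and the horizontal vector `(0, M(ξ)ᵀ y)`. -/
theorem mulVec_cons_zero {d : ℕ} (G : Matrix (Fin (d + 1)) (Fin (d + 1)) ℝ)
    {ξ : Fin d → ℝ} (hf : fH ξ ≠ 0) (y : Fin d → ℝ) :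
    G *ᵥ (Fin.cons 0 y : Fin (d + 1) → ℝ) =
      (bH G ⬝ᵥ y / fH ξ) • sigmaH ξ + (Fin.cons 0 ((MH G ξ)ᵀ *ᵥ y) : Fin (d + 1) → ℝ) := by
  ext i
  refine Fin.cases ?_ (fun i => ?_) i
  · simp [mulVec, dotProduct, Fin.sum_univ_succ, sigmaH, bH_apply, hf]
  · rw [MH_transpose_mulVec]
    simp [mulVec, dotProduct, Fin.sum_univ_succ, sigmaH, G0H]

theorem sigmaH_dotProduct_aH {d : ℕ} (G : Matrix (Fin (d + 1)) (Fin (d + 1)) ℝ)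
    (ξ : Fin d → ℝ) : sigmaH ξ ⬝ᵥ aH G = (G⁻¹ *ᵥ sigmaH ξ) 0 := by
  rw [aH, ← transpose_nonsing_inv, mulVec_transpose, dotProduct_comm, ← dotProduct_mulVec,
    e0H_dotProduct]

theorem isUnit_det_MH_transpose {d : ℕ} {G : Matrix (Fin (d + 1)) (Fin (d + 1)) ℝ}
    (hG : IsUnit G.det) {ξ : Fin d → ℝ} (hf : fH ξ ≠ 0) (ha : sigmaH ξ ⬝ᵥ aH G ≠ 0) :
    IsUnit (MH G ξ)ᵀ.det := by
  rw [isUnit_iff_ne_zero]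
  intro hdet
  obtain ⟨y, hy0, hy⟩ := exists_mulVec_eq_zero_iff.2 hdet
  have h := mulVec_cons_zero G hf y
  have hz : (Fin.cons 0 (0 : Fin d → ℝ) : Fin (d + 1) → ℝ) = 0 := by
    ext i
    refine Fin.cases ?_ (fun i => ?_) i <;> simp
  rw [hy, hz, add_zero] at h
  have h' := congrArg (G⁻¹ *ᵥ ·) h
  simp only [mulVec_mulVec, nonsing_inv_mul G hG, one_mulVec, mulVec_smul] at h'
  have h0 := congrFun h' 0
  rw [Pi.smul_apply, ← sigmaH_dotProduct_aH, Fin.cons_zero, smul_eq_mul, eq_comm] at h0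
  rw [(mul_eq_zero.1 h0).resolve_right ha, zero_smul] at h'
  exact hy0 (funext fun i => by simpa using congrFun h' i.succ)

/-- Ray lemma, affine case: for `𝒢(X) = G X + γ`, with
`(x_B, ξ_B) = κ_{U_G}(κ_{U_γ}(x_A, ξ_A))`, `A = (0, x_A)` and `B = G·(0, x_B) + γ`,
the vector `B − A` is collinear to `σ(ξ_A)`. -/
theorem stmt_16 (d : ℕ) (hd : 1 ≤ d) (G : Matrix (Fin (d + 1)) (Fin (d + 1)) ℝ)
    (hG : IsUnit G.det) (γ₀ : ℝ) (γ' : Fin d → ℝ)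
    (xA ξA : Fin d → ℝ) (hξA : ξA ⬝ᵥ ξA < 1) (ha : sigmaH ξA ⬝ᵥ aH G ≠ 0) :
    ∃ l : ℝ,
      (G.mulVec (Fin.cons 0 (kappaG G (kappaT γ₀ γ' (xA, ξA))).1) + Fin.cons γ₀ γ')
          - Fin.cons 0 xA
        = l • sigmaH ξA := by
  have hf := fH_ne_zero hξA
  have hM := isUnit_det_MH_transpose hG hf ha
  set y := (kappaG G (kappaT γ₀ γ' (xA, ξA))).1 with hy
  have hMy : (MH G ξA)ᵀ *ᵥ y = xA + (γ₀ / fH ξA) • ξA - γ' := by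
    simp [hy, kappaG, kappaT, mulVec_mulVec, mul_nonsing_inv _ hM]
  refine ⟨(bH G ⬝ᵥ y + γ₀) / fH ξA, ?_⟩
  rw [mulVec_cons_zero G hf, hMy]
  ext i
  refine Fin.cases ?_ (fun i => ?_) i
  · simp [sigmaH, hf]
  · simp only [sigmaH, Pi.sub_apply, Pi.add_apply, Pi.smul_apply, Fin.cons_succ, smul_eq_mul]
    ring

end
end
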